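/- For every integer d ≥ 1 there exists a constant c > 0, depending only on d, such that for every integer N ≥ 3 the following holds: if 0 is an eigenvalue of the discrete torus T^d_N and d ∈ I(0;N), then the multiplicity satisfies m_{T^d_N}(0) ≥ c·N. -/

import Mathlib

/-- The multiplicity of `μ` as an eigenvalue of the discrete torus `T^d_N`:
the number of tuples `(k_1, …, k_d) ∈ {0, …, N-1}^d` with
`∑_j 2 cos(2π k_j / N) = μ`. -/
noncomputable def torusMult (N d : ℕ) (μ : ℝ) : ℕ :=
  Nat.card {k : Fin d → Fin N //
    (∑ j, 2 * Real.cos (2 * Real.pi * (k j : ℝ) / N)) = μ}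

/-- The set `I(0;N)`: positive integers `r` such that `2r = ∑ b_l p_l` over the
distinct prime factors `p_l` of `N`, with at least one `b_l ≥ 2`. -/
def IZeroSet (N : ℕ) : Set ℕ :=
  {r | 0 < r ∧ ∃ b : ℕ → ℕ,
    2 * r = ∑ p ∈ N.primeFactors, b p * p ∧ ∃ p ∈ N.primeFactors, 2 ≤ b p}

/-- A vanishing sum of `N`-th roots of unity still vanishes after a Galois conjugation. -/
theorem sum_pow_eq_zero_of_coprime {ι : Type*} {N u : ℕ} (hN : N ≠ 0) (hu : u.Coprime N)
    (s : Finset ι) (z : ι → ℂ) (hz : ∀ j ∈ s, z j ^ N = 1) (h0 : ∑ j ∈ s, z j = 0) :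
    ∑ j ∈ s, z j ^ u = 0 := by
  classical
  have hζ := Complex.isPrimitiveRoot_exp N hN
  set ζ := Complex.exp (2 * Real.pi * Complex.I / N)
  have : NeZero N := ⟨hN⟩
  have hk : ∀ j, ∃ k : ℕ, j ∈ s → ζ ^ k = z j := fun j => by
    by_cases hj : j ∈ s
    · obtain ⟨k, -, hk⟩ := hζ.eq_pow_of_pow_eq_one (hz j hj)
      exact ⟨k, fun _ => hk⟩
    · exact ⟨0, fun h => absurd h hj⟩
  choose k hk using hk
  let P : Polynomial ℤ := ∑ j ∈ s, Polynomial.X ^ k j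
  have hP : ∀ x : ℂ, Polynomial.aeval x P = ∑ j ∈ s, x ^ k j := fun x => by simp [P]
  have hroot : Polynomial.aeval ζ P = 0 := by
    rw [hP, ← h0]
    exact Finset.sum_congr rfl hk
  have hdvd : minpoly ℤ ζ ∣ P :=
    minpoly.isIntegrallyClosed_dvd (hζ.isIntegral (Nat.pos_of_ne_zero hN)) hroot
  rw [hζ.minpoly_eq_pow_coprime hu] at hdvd
  have := Polynomial.aeval_eq_zero_of_dvd_aeval_eq_zero hdvd (minpoly.aeval ℤ (ζ ^ u))
  rw [hP] at this
  rw [← this]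
  refine Finset.sum_congr rfl fun j hj => ?_
  rw [← hk j hj, ← pow_mul, ← pow_mul, mul_comm]

theorem exists_coprime_one_add_mul {q M : ℕ} (hq : q.Prime) :
    ∃ r < q, ∀ s < q, s ≠ r → (1 + M * s).Coprime (q * M) := by
  have key : ∀ s, ¬ q ∣ 1 + M * s → (1 + M * s).Coprime (q * M) := fun s hs =>
    Nat.Coprime.mul_right ((hq.coprime_iff_not_dvd.2 hs).symm) (by simp)
  by_cases h : ∃ r < q, q ∣ 1 + M * r
  · obtain ⟨r, hr, hqr⟩ := h
    refine ⟨r, hr, fun s hs hsr => key s fun hqs => hsr ?_⟩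
    have hM : ¬ q ∣ M := fun hM => hq.one_lt.ne'
      (Nat.dvd_one.1 ((Nat.dvd_add_iff_left (hM.mul_right r)).2 hqr))
    have hmod : M * s ≡ M * r [MOD q] := by
      refine Nat.ModEq.add_left_cancel' 1 ?_
      exact ((Nat.modEq_zero_iff_dvd.2 hqs).trans (Nat.modEq_zero_iff_dvd.2 hqr).symm)
    have := Nat.ModEq.cancel_left_of_coprime
      ((hq.coprime_iff_not_dvd.2 hM)) hmod
    exact Nat.ModEq.eq_of_lt_of_lt this hs hr
  · push Not at h
    exact ⟨0, hq.pos, fun s hs _ => key s (h s hs)⟩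

theorem sum_range_pow_of_pow_eq_one {q : ℕ} {x : ℂ} (hx : x ^ q = 1) :
    ∑ i ∈ Finset.range q, x ^ i = if x = 1 then (q : ℂ) else 0 := by
  split_ifs with h
  · simp [h]
  · rw [geom_sum_eq h, hx, sub_self, zero_div]

/-- In a vanishing sum of `qM`-th roots of unity with `q` prime, the partial sums over the
cosets of the `M`-th roots of unity agree up to roots of unity. -/
theorem exists_sum_filter_pow_eq {ι : Type*} {q M : ℕ} (hq : q.Prime) (hM : M ≠ 0)
    (s : Finset ι) (z : ι → ℂ) (hz : ∀ j ∈ s, z j ^ (q * M) = 1) (h0 : ∑ j ∈ s, z j = 0) :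
    ∃ (r : ℕ) (K : ℂ), ∀ v : ℂ, v ^ q = 1 → ∑ j ∈ s with z j ^ M = v, z j = v⁻¹ ^ r * K := by
  obtain ⟨r, hrq, hr⟩ := exists_coprime_one_add_mul (M := M) hq
  have hq0 : (q : ℂ) ≠ 0 := Nat.cast_ne_zero.2 hq.ne_zero
  let T : ℕ → ℂ := fun i => ∑ j ∈ s, z j ^ (1 + M * i)
  have hT : ∀ i < q, i ≠ r → T i = 0 := fun i hi hir =>
    sum_pow_eq_zero_of_coprime (mul_ne_zero hq.ne_zero hM) (hr i hi hir) s z hz h0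
  refine ⟨r, T r / q, fun v hv => ?_⟩
  have hv0 : v ≠ 0 := fun h => by simp [h, hq.ne_zero] at hv
  have h1 : ∑ i ∈ Finset.range q, v⁻¹ ^ i * T i = v⁻¹ ^ r * T r := by
    rw [Finset.sum_eq_single r]
    · intro i hi hir
      rw [hT i (Finset.mem_range.1 hi) hir, mul_zero]
    · exact fun h => absurd (Finset.mem_range.2 hrq) h
  have h2 : ∑ i ∈ Finset.range q, v⁻¹ ^ i * T i = q * ∑ j ∈ s with z j ^ M = v, z j := by
    simp only [T, Finset.mul_sum]
    rw [Finset.sum_comm, Finset.sum_filter]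
    refine Finset.sum_congr rfl fun j hj => ?_
    have hx : (v⁻¹ * z j ^ M) ^ q = 1 := by
      rw [mul_pow, inv_pow, hv, ← pow_mul, mul_comm M, hz j hj, inv_one, one_mul]
    have hiff : v⁻¹ * z j ^ M = 1 ↔ z j ^ M = v := by
      rw [inv_mul_eq_one₀ hv0, eq_comm]
    calc ∑ i ∈ Finset.range q, v⁻¹ ^ i * z j ^ (1 + M * i)
        = z j * ∑ i ∈ Finset.range q, (v⁻¹ * z j ^ M) ^ i := by
          rw [Finset.mul_sum]
          refine Finset.sum_congr rfl fun i _ => ?_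
          rw [pow_add, pow_one, pow_mul, mul_pow]
          ring
      _ = _ := by
          rw [sum_range_pow_of_pow_eq_one hx]
          simp only [hiff]
          split_ifs <;> ring
  rw [mul_div_assoc', eq_div_iff hq0, ← h1, h2, mul_comm]

/-- A vanishing sum of `2m`-th roots of unity with fewer terms than every prime factor of `m`
has an even number of terms. -/
theorem even_card_of_sum_eq_zero {m : ℕ} (hm : m ≠ 0) :
    ∀ {ι : Type} (s : Finset ι) (z : ι → ℂ), (∀ j ∈ s, z j ^ (2 * m) = 1) →
      ∑ j ∈ s, z j = 0 → (∀ p : ℕ, p.Prime → p ∣ m → s.card < p) → Even s.card := by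
  induction m using induction_on_primes with
  | zero => exact absurd rfl hm
  | one =>
    intro ι s z hz h0 _
    have hz1 : ∀ j ∈ s, z j = 1 ∨ z j = -1 := fun j hj => by
      rw [← mul_self_eq_one_iff, ← sq]
      exact hz j hj
    classical
    have h1 : ∑ j ∈ s, z j = ((∑ j ∈ s, if z j = 1 then (1 : ℤ) else -1 : ℤ) : ℂ) := by
      push_cast
      refine Finset.sum_congr rfl fun j hj => ?_
      rcases hz1 j hj with h | h
      · simp [h]
      · rw [h, if_neg (by norm_num)]
    rw [h0] at h1
    have h2 := Int.cast_eq_zero.1 h1.symm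
    have h3 : Even (∑ j ∈ s, ((if z j = 1 then (1 : ℤ) else -1) + 1)) :=
      Finset.even_sum _ fun j _ => by split_ifs <;> decide
    rw [Finset.sum_add_distrib, h2, zero_add, Finset.sum_const, nsmul_one] at h3
    exact_mod_cast h3
  | prime_mul q a hq ih =>
    intro ι s z hz h0 hp
    classical
    have ha : a ≠ 0 := right_ne_zero_of_mul hm
    have hN : 2 * (q * a) = q * (2 * a) := by ring
    rw [hN] at hz
    obtain ⟨r, K, hK⟩ := exists_sum_filter_pow_eq hq (by omega) s z hz h0
    have hcard : (s.image fun j => z j ^ (2 * a)).card <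
        (Polynomial.nthRootsFinset q (1 : ℂ)).card := by
      rw [(Complex.isPrimitiveRoot_exp q hq.ne_zero).card_nthRootsFinset]
      exact Finset.card_image_le.trans_lt (hp q hq (dvd_mul_right q a))
    obtain ⟨v, hv, hvs⟩ := Finset.exists_mem_notMem_of_card_lt_card hcard
    rw [Polynomial.mem_nthRootsFinset hq.pos] at hv
    have hv0 : v ≠ 0 := fun h => by simp [h, hq.ne_zero] at hv
    have hK0 : K = 0 := by
      have := hK v hv
      rw [Finset.filter_false_of_mem, Finset.sum_empty] at this
      · simpa [hv0] using this.symm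
      · exact fun j hj h => hvs (Finset.mem_image.2 ⟨j, hj, h⟩)
    rw [Finset.card_eq_sum_card_image (fun j => z j ^ (2 * a)) s]
    refine Finset.even_sum _ fun w hw => ?_
    obtain ⟨i, hi, rfl⟩ := Finset.mem_image.1 hw
    have hzi : z i ≠ 0 := fun h => by simpa [h, hq.ne_zero, ha] using hz i hi
    refine ih ha _ (fun j => z j / z i) (fun j hj => ?_) ?_ fun p hpp hpa =>
      (Finset.card_filter_le _ _).trans_lt (hp p hpp (hpa.mul_left q))
    · rw [div_pow, (Finset.mem_filter.1 hj).2, div_self (pow_ne_zero _ hzi)]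
    · rw [← Finset.sum_div, hK _ (by rw [← pow_mul, mul_comm, hz i hi]), hK0, mul_zero, zero_div]

/-- A vanishing sum of terms `z + z⁻¹` over `2m`-th roots of unity, with `m` odd and fewer terms
than every prime factor of `m`, has an even number of terms. -/
theorem even_card_of_sum_add_inv_eq_zero {m : ℕ} (hm : Odd m) :
    ∀ {ι : Type} (s : Finset ι) (z : ι → ℂ), (∀ j ∈ s, z j ^ (2 * m) = 1) →
      ∑ j ∈ s, (z j + (z j)⁻¹) = 0 → (∀ p : ℕ, p.Prime → p ∣ m → s.card < p) → Even s.card := by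
  induction m using induction_on_primes with
  | zero => simp at hm
  | one =>
    intro ι s z hz h0 hp
    refine even_card_of_sum_eq_zero one_ne_zero s z hz ?_ hp
    have h1 : ∑ j ∈ s, (z j + (z j)⁻¹) = 2 * ∑ j ∈ s, z j := by
      rw [Finset.mul_sum]
      refine Finset.sum_congr rfl fun j hj => ?_
      rw [inv_eq_of_mul_eq_one_left (by rw [← sq]; exact hz j hj), two_mul]
    simpa [h0] using h1.symm
  | prime_mul q a hq ih =>
    intro ι s z hz h0 hp
    classical
    have ha : Odd a := (Nat.odd_mul.1 hm).2
    have hqo : Odd q := (Nat.odd_mul.1 hm).1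
    have ha0 : a ≠ 0 := ha.pos.ne'
    have hqa : q * a ≠ 0 := mul_ne_zero hq.ne_zero ha0
    have hN : 2 * (q * a) = q * (2 * a) := by ring
    have hz0 : ∀ j ∈ s, z j ≠ 0 := fun j hj h => by simpa [h, hq.ne_zero, ha0] using hz j hj
    have hinv : ∀ j ∈ s, (z j)⁻¹ ^ (2 * (q * a)) = 1 := fun j hj => by
      rw [inv_pow, hz j hj, inv_one]
    let y : ι ⊕ ι → ℂ := Sum.elim z fun j => (z j)⁻¹
    let S : Finset (ι ⊕ ι) := s.disjSum s
    have hy : ∀ x ∈ S, y x ^ (q * (2 * a)) = 1 := by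
      rw [← hN]
      rintro (x | x) hx
      · exact hz x (Finset.inl_mem_disjSum.1 hx)
      · exact hinv x (Finset.inr_mem_disjSum.1 hx)
    have hy0 : ∑ x ∈ S, y x = 0 := by
      rw [← h0, Finset.sum_disjSum, Finset.sum_add_distrib]
      rfl
    have hclass : ∀ v : ℂ, ∑ x ∈ S with y x ^ (2 * a) = v, y x =
        (∑ j ∈ s with z j ^ (2 * a) = v, z j) +
          ∑ j ∈ s with z j ^ (2 * a) = v⁻¹, (z j)⁻¹ := fun v => by
      simp only [Finset.sum_filter, S, Finset.sum_disjSum, y, Sum.elim_inl, Sum.elim_inr,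
        inv_pow, inv_eq_iff_eq_inv]
      congr!
    have hcount : ∀ v : ℂ, ({x ∈ S | y x ^ (2 * a) = v} : Finset (ι ⊕ ι)).card =
        ({j ∈ s | z j ^ (2 * a) = v} : Finset ι).card +
          ({j ∈ s | z j ^ (2 * a) = v⁻¹} : Finset ι).card := fun v => by
      simp only [Finset.card_filter, S, Finset.sum_disjSum, y, Sum.elim_inl, Sum.elim_inr,
        inv_pow, inv_eq_iff_eq_inv]
      congr!
    obtain ⟨r, K, hK⟩ := exists_sum_filter_pow_eq hq (by omega) S y hy hy0
    have hsq : s.card < q := hp q hq (dvd_mul_right q a)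
    by_cases hK0 : K = 0
    · -- every coset has vanishing sum
      simp only [hK0, mul_zero] at hK
      let f : ι → ℂ := fun j => z j ^ (2 * a) + (z j ^ (2 * a))⁻¹
      rw [Finset.card_eq_sum_card_image f s]
      refine Finset.even_sum _ fun w hw => ?_
      obtain ⟨i, hi, rfl⟩ := Finset.mem_image.1 hw
      have hlt : ∀ p : ℕ, p.Prime → p ∣ q * a →
          ({j ∈ s | f j = f i} : Finset ι).card < p := fun p hpp hpa =>
        (Finset.card_filter_le _ _).trans_lt (hp p hpp hpa)
      set v := z i ^ (2 * a) with hv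
      have hvq : v ^ q = 1 := by rw [hv, ← pow_mul, mul_comm, ← hN, hz i hi]
      have hv0 : v ≠ 0 := pow_ne_zero _ (hz0 i hi)
      have hf : ∀ j ∈ s, f j = f i ↔ z j ^ (2 * a) = v ∨ z j ^ (2 * a) = v⁻¹ := fun j hj => by
        have hj0 : z j ^ (2 * a) ≠ 0 := pow_ne_zero _ (hz0 j hj)
        simp only [f, ← hv]
        generalize z j ^ (2 * a) = u at hj0
        constructor
        · intro h
          have h1 : (u - v) * (u - v⁻¹) = 0 := by
            field_simp at h ⊢
            linear_combination h
          rcases mul_eq_zero.1 h1 with h | h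
          · exact Or.inl (sub_eq_zero.1 h)
          · exact Or.inr (sub_eq_zero.1 h)
        · rintro (rfl | rfl)
          · rfl
          · rw [inv_inv, add_comm]
      have hS := hK v hvq
      rw [hclass] at hS
      by_cases hv1 : v = 1
      · rw [hv1, inv_one, ← Finset.sum_add_distrib] at hS
        have hF : ({j ∈ s | f j = f i} : Finset ι) = {j ∈ s | z j ^ (2 * a) = 1} :=
          Finset.filter_congr fun j hj => by rw [hf j hj, hv1, inv_one, or_self]
        rw [hF] at hlt ⊢
        exact ih ha _ z (fun j hj => (Finset.mem_filter.1 hj).2) hS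
          fun p hpp hpa => hlt p hpp (hpa.mul_left q)
      · have hvv : v ≠ v⁻¹ := fun h => hv1 <| by
          have h2 : v ^ 2 = 1 := by
            rw [sq]
            nth_rewrite 2 [h]
            exact mul_inv_cancel₀ hv0
          obtain ⟨k, rfl⟩ := hqo
          rwa [pow_succ, pow_mul, h2, one_pow, one_mul] at hvq
        refine even_card_of_sum_eq_zero hqa _
          (fun j => if z j ^ (2 * a) = v then z j else (z j)⁻¹) (fun j hj => ?_) ?_ hlt
        · have hj := (Finset.mem_filter.1 hj).1
          split_ifs
          exacts [hz j hj, hinv j hj]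
        · rw [← hS, Finset.sum_filter, Finset.sum_filter, Finset.sum_filter,
            ← Finset.sum_add_distrib]
          refine Finset.sum_congr rfl fun j hj => ?_
          rw [if_congr (hf j hj) rfl rfl]
          by_cases h1 : z j ^ (2 * a) = v
          · simp [h1, hvv]
          · by_cases h2 : z j ^ (2 * a) = v⁻¹
            · simp [h2, hvv.symm]
            · simp [h1, h2]
    -- every coset meets the sum, so some nontrivial coset contains a single term
    · by_contra hodd
      have hsq2 : s.card + 2 ≤ q := by
        rw [Nat.not_even_iff_odd] at hodd
        obtain ⟨k, hk⟩ := hodd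
        obtain ⟨l, hl⟩ := hqo
        omega
      let n : ℂ → ℕ := fun v => ({x ∈ S | y x ^ (2 * a) = v} : Finset (ι ⊕ ι)).card
      let R : Finset ℂ := Polynomial.nthRootsFinset q (1 : ℂ)
      have hR : ∀ v, v ∈ R ↔ v ^ q = 1 := fun v => Polynomial.mem_nthRootsFinset hq.pos 1
      have hRcard : R.card = q :=
        (Complex.isPrimitiveRoot_exp q hq.ne_zero).card_nthRootsFinset
      have h1R : (1 : ℂ) ∈ R := (hR 1).2 (one_pow q)
      have hn : ∀ v ∈ R, 1 ≤ n v := fun v hv => by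
        rw [hR] at hv
        have hv0 : v ≠ 0 := fun h => by simp [h, hq.ne_zero] at hv
        refine Nat.one_le_iff_ne_zero.2 fun h => ?_
        have := hK v hv
        rw [Finset.card_eq_zero.1 h, Finset.sum_empty] at this
        simp [hv0, hK0] at this
      have hsum : ∑ v ∈ R, n v = 2 * s.card := by
        rw [← Finset.card_eq_sum_card_fiberwise, Finset.card_disjSum, two_mul]
        intro x hx
        exact (hR _).2 (by rw [← pow_mul, mul_comm, hy x hx])
      rw [← Finset.add_sum_erase R n h1R] at hsum
      have hcard' : (R.erase 1).card = q - 1 := by rw [Finset.card_erase_of_mem h1R, hRcard]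
      have hn1 : Even (n 1) := by
        simp only [n, hcount, inv_one]
        exact ⟨_, rfl⟩
      have hn1' : 1 ≤ n 1 := hn 1 h1R
      obtain ⟨v, hvR, hv1⟩ : ∃ v ∈ R, n v = 1 := by
        by_contra! h
        have : (R.erase 1).card • 2 ≤ ∑ v ∈ R.erase 1, n v :=
          Finset.card_nsmul_le_sum (R.erase 1) n 2 fun v hv => by
          have hvR := Finset.mem_of_mem_erase hv
          have := hn v hvR
          have := h v hvR
          omega
        rw [hcard', smul_eq_mul] at this
        omega
      have hle : (R.erase 1).card • 1 ≤ ∑ v ∈ R.erase 1, n v :=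
          Finset.card_nsmul_le_sum (R.erase 1) n 1 fun v hv =>
        hn v (Finset.mem_of_mem_erase hv)
      rw [hcard', smul_eq_mul] at hle
      obtain ⟨x, hx⟩ := Finset.card_eq_one.1 hv1
      have hxS : x ∈ S := Finset.mem_of_mem_filter x (hx ▸ Finset.mem_singleton_self x)
      have hvq := (hR v).1 hvR
      have hv0 : v ≠ 0 := fun h => by simp [h, hq.ne_zero] at hvq
      have hKx : K = v ^ r * y x := by
        have := hK v hvq
        rw [hx, Finset.sum_singleton] at this
        rw [this, inv_pow, mul_inv_cancel_left₀ (pow_ne_zero _ hv0)]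
      have hK1 := hK 1 (one_pow q)
      rw [inv_one, one_pow, one_mul] at hK1
      have := even_card_of_sum_eq_zero hqa
        (Finset.insertNone {x ∈ S | y x ^ (2 * a) = 1}) (fun o => o.elim (-K) y) ?_ ?_ ?_
      · rw [Finset.card_insertNone, Nat.even_add_one] at this
        exact this hn1
      · rw [hN]
        rintro (_ | x') hx'
        · change (-K) ^ (q * (2 * a)) = 1
          have he : Even (q * (2 * a)) := ⟨q * a, by ring⟩
          rw [he.neg_pow, hKx, mul_pow, hy x hxS, mul_one, ← pow_mul, mul_comm r, mul_assoc,
            pow_mul, hvq, one_pow]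
        · exact hy x' (Finset.mem_of_mem_filter x' (Finset.some_mem_insertNone.1 hx'))
      · rw [Finset.sum_insertNone]
        change -K + ∑ x ∈ S with y x ^ (2 * a) = 1, y x = 0
        rw [hK1, neg_add_cancel]
      · intro p hpp hpd
        refine lt_of_le_of_lt ?_ (hp p hpp hpd)
        rw [Finset.card_insertNone]
        change n 1 + 1 ≤ _
        omega

/-- `x` is a sum of `r` terms of the form `2 cos(2πk/N)`. -/
def IsCosSum (N r : ℕ) (x : ℝ) : Prop :=
  ∃ k : Fin r → ℕ, ∑ j, 2 * Real.cos (2 * Real.pi * (k j : ℝ) / N) = x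

namespace IsCosSum

variable {N : ℕ}

theorem zero : IsCosSum N 0 0 := ⟨fun _ => 0, by simp⟩

theorem add {r s : ℕ} {x y : ℝ} (hx : IsCosSum N r x) (hy : IsCosSum N s y) :
    IsCosSum N (r + s) (x + y) := by
  obtain ⟨k, rfl⟩ := hx
  obtain ⟨l, rfl⟩ := hy
  exact ⟨Fin.append k l, by simp [Fin.sum_univ_add]⟩

theorem mul {r : ℕ} {x : ℝ} (hx : IsCosSum N r x) (n : ℕ) : IsCosSum N (n * r) (n * x) := by
  induction n with
  | zero => simpa using zero
  | succ n ih => simpa [add_mul] using ih.add hx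

theorem sum {ι : Type*} (s : Finset ι) {r : ι → ℕ} {x : ι → ℝ}
    (h : ∀ i ∈ s, IsCosSum N (r i) (x i)) : IsCosSum N (∑ i ∈ s, r i) (∑ i ∈ s, x i) := by
  classical
  induction s using Finset.induction_on with
  | empty => simpa using zero
  | insert a s ha ih =>
    rw [Finset.sum_insert ha, Finset.sum_insert ha]
    exact (h a (Finset.mem_insert_self a s)).add
      (ih fun i hi => h i (Finset.mem_insert_of_mem hi))

theorem two : IsCosSum N 1 2 := ⟨fun _ => 0, by simp⟩

theorem of_four_dvd (hN : N ≠ 0) (h : 4 ∣ N) : IsCosSum N 1 0 := by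
  obtain ⟨M, rfl⟩ := h
  have hM : (M : ℝ) ≠ 0 := by
    rintro h
    simp_all
  refine ⟨fun _ => M, ?_⟩
  have : 2 * Real.pi * M / (4 * M : ℕ) = Real.pi / 2 := by
    push_cast
    field_simp
    ring
  simp [this, -Nat.cast_mul]

theorem of_two_dvd (hN : N ≠ 0) (h : 2 ∣ N) : IsCosSum N 2 0 := by
  obtain ⟨M, rfl⟩ := h
  have hM : (M : ℝ) ≠ 0 := by
    rintro h
    simp_all
  refine ⟨![0, M], ?_⟩
  have : 2 * Real.pi * M / (2 * M : ℕ) = Real.pi := by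
    push_cast
    field_simp
  simp [this, -Nat.cast_mul]

end IsCosSum

theorem sum_range_cos_add_eq_zero {p : ℕ} (hp : 1 < p) (x : ℝ) :
    ∑ i ∈ Finset.range p, Real.cos (x + 2 * Real.pi * i / p) = 0 := by
  have h := (Complex.isPrimitiveRoot_exp p (by omega)).geom_sum_eq_zero hp
  have h1 : ∀ i : ℕ, Real.cos (x + 2 * Real.pi * i / p) =
      (Complex.exp (x * Complex.I) * Complex.exp (2 * Real.pi * Complex.I / p) ^ i).re := fun i => by
    rw [← Complex.exp_ofReal_mul_I_re, ← Complex.exp_nat_mul, ← Complex.exp_add]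
    congr 2
    push_cast
    ring
  simp_rw [h1]
  rw [← Complex.re_sum, ← Finset.mul_sum, h, mul_zero, Complex.zero_re]

theorem two_mul_sum_range_cos {h : ℕ} (hh : h ≠ 0) :
    2 * ∑ i ∈ Finset.range h, Real.cos (2 * Real.pi * (i + 1 : ℕ) / (2 * h + 1 : ℕ)) = -1 := by
  have h0 := sum_range_cos_add_eq_zero (p := 2 * h + 1) (by omega) 0
  rw [Finset.sum_range_succ', two_mul h, Finset.sum_range_add,
    ← Finset.sum_range_reflect (fun i => Real.cos (0 + 2 * Real.pi * (h + i + 1 : ℕ) / _)),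
    ← two_mul h] at h0
  have h1 : ∀ i ∈ Finset.range h,
      Real.cos (0 + 2 * Real.pi * (h + (h - 1 - i) + 1 : ℕ) / (2 * h + 1 : ℕ)) =
        Real.cos (2 * Real.pi * (i + 1 : ℕ) / (2 * h + 1 : ℕ)) := fun i hi => by
    have hi := Finset.mem_range.1 hi
    rw [← Real.cos_two_pi_sub (2 * Real.pi * (i + 1 : ℕ) / (2 * h + 1 : ℕ))]
    congr 1
    have h2 : ((h + (h - 1 - i) + 1 : ℕ) : ℝ) = (2 * h + 1 : ℕ) - (i + 1 : ℕ) := by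
      rw [eq_sub_iff_add_eq]
      norm_cast
      omega
    rw [h2]
    have : ((2 * h + 1 : ℕ) : ℝ) ≠ 0 := by positivity
    field_simp
    ring
  rw [Finset.sum_congr rfl h1] at h0
  simp only [zero_add, Nat.cast_zero, mul_zero, zero_div, Real.cos_zero] at h0
  linarith

theorem IsCosSum.of_odd_dvd {N h : ℕ} (hN : N ≠ 0) (hh : h ≠ 0) (hd : 2 * h + 1 ∣ N) :
    IsCosSum N h (-1) := by
  obtain ⟨M, rfl⟩ := hd
  have hM : (M : ℝ) ≠ 0 := by
    rintro h
    simp_all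
  refine ⟨fun i => (i + 1) * M, ?_⟩
  rw [← two_mul_sum_range_cos hh, Finset.mul_sum, Finset.sum_range]
  refine Finset.sum_congr rfl fun i _ => ?_
  push_cast
  congr 2
  field_simp

theorem cos_mod_div (N x : ℕ) (hN : N ≠ 0) :
    Real.cos (2 * Real.pi * (x % N : ℕ) / N) = Real.cos (2 * Real.pi * x / N) := by
  have hN' : (N : ℝ) ≠ 0 := Nat.cast_ne_zero.2 hN
  rw [← Real.cos_add_nat_mul_two_pi _ (x / N)]
  congr 1
  have h : (x : ℝ) = (x % N : ℕ) + N * (x / N : ℕ) := by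
    exact_mod_cast (Nat.mod_add_div x N).symm
  rw [h]
  field_simp

theorem le_torusMult_of_isCosSum {N p r : ℕ} (hN : N ≠ 0) (hp : 1 < p) (hpN : p ∣ N)
    (hr : IsCosSum N r 0) : N ≤ torusMult N (p + r) 0 := by
  obtain ⟨k, hk⟩ := hr
  obtain ⟨M, hM⟩ := hpN
  have : NeZero N := ⟨hN⟩
  have hM0 : (M : ℝ) ≠ 0 := by
    rintro h
    simp_all
  have hp0 : (p : ℝ) ≠ 0 := by positivity
  let g : Fin N → Fin (p + r) → Fin N := fun t =>
    Fin.append (fun i => Fin.ofNat N (t + i * M)) (fun j => Fin.ofNat N (k j))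
  have hg : ∀ t, ∑ j, 2 * Real.cos (2 * Real.pi * (g t j : ℝ) / N) = 0 := fun t => by
    simp only [Fin.sum_univ_add, g, Fin.append_left, Fin.append_right, Fin.val_ofNat,
      cos_mod_div _ _ hN, hk, add_zero]
    rw [← Finset.mul_sum, Fin.sum_univ_eq_sum_range
      (fun i => Real.cos (2 * Real.pi * ((t + i * M : ℕ) : ℝ) / N)),
      ← mul_zero (2 : ℝ), ← sum_range_cos_add_eq_zero hp (2 * Real.pi * t / N)]
    congr 1
    refine Finset.sum_congr rfl fun i _ => ?_
    congr 1
    have hM' : (N : ℝ) = p * M := by exact_mod_cast hM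
    rw [hM']
    push_cast
    field_simp
  have hinj : Function.Injective fun t : Fin N =>
      (⟨g t, hg t⟩ : {k : Fin (p + r) → Fin N //
        (∑ j, 2 * Real.cos (2 * Real.pi * (k j : ℝ) / N)) = 0}) := fun t t' h => by
    have h1 := congrFun (Subtype.ext_iff.1 h) (Fin.castAdd r ⟨0, by omega⟩)
    simp only [g, Fin.append_left] at h1
    simpa using h1
  have hcard := Nat.card_le_card_of_injective _ hinj
  rwa [Nat.card_eq_fintype_card, Fintype.card_fin] at hcard

theorem isCosSum_zero_of_odd {N r : ℕ} (hN : Odd N) (b : ℕ → ℕ)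
    (hb : 2 * r = ∑ p ∈ N.primeFactors, b p * p) : IsCosSum N r 0 := by
  have hodd : ∀ p ∈ N.primeFactors, ∃ h, h ≠ 0 ∧ p = 2 * h + 1 := fun p hp => by
    obtain ⟨h, hh⟩ := hN.of_dvd_nat (Nat.dvd_of_mem_primeFactors hp)
    have := (Nat.prime_of_mem_primeFactors hp).one_lt
    exact ⟨h, by omega, hh⟩
  have hsum : 2 * r = 2 * ∑ p ∈ N.primeFactors, b p * (p / 2) + ∑ p ∈ N.primeFactors, b p := by
    rw [hb, Finset.mul_sum, ← Finset.sum_add_distrib]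
    refine Finset.sum_congr rfl fun p hp => ?_
    obtain ⟨h, -, rfl⟩ := hodd p hp
    rw [show (2 * h + 1) / 2 = h by omega]
    ring
  obtain ⟨B, hB⟩ : ∃ B, ∑ p ∈ N.primeFactors, b p = 2 * B :=
    ⟨r - ∑ p ∈ N.primeFactors, b p * (p / 2), by omega⟩
  have h1 : IsCosSum N (∑ p ∈ N.primeFactors, b p * (p / 2))
      (∑ p ∈ N.primeFactors, (b p : ℝ) * -1) :=
    IsCosSum.sum _ fun p hp => by
      obtain ⟨h, hh, rfl⟩ := hodd p hp
      rw [show (2 * h + 1) / 2 = h by omega]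
      exact (IsCosSum.of_odd_dvd hN.pos.ne' hh (Nat.dvd_of_mem_primeFactors hp)).mul _
  have h2 := h1.add (IsCosSum.two.mul B)
  rw [← Finset.sum_mul, ← Nat.cast_sum, hB] at h2
  convert h2 using 1
  · omega
  · push_cast
    ring

theorem even_of_isCosSum_zero {m d : ℕ} (hm : Odd m) (hd : ∀ p : ℕ, p.Prime → p ∣ m → d < p)
    (h : IsCosSum (2 * m) d 0) : Even d := by
  obtain ⟨k, hk⟩ := h
  have hζ := Complex.isPrimitiveRoot_exp (2 * m) (by have := hm.pos; omega)
  have key := even_card_of_sum_add_inv_eq_zero hm Finset.univ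
    (fun j => Complex.exp (2 * Real.pi * Complex.I / (2 * m : ℕ)) ^ k j) (fun j _ => ?_) ?_
    (by simpa using hd)
  · simpa using key
  · rw [← pow_mul, mul_comm (k j), pow_mul, hζ.pow_eq_one, one_pow]
  · rw [← Complex.ofReal_zero, ← hk]
    push_cast
    refine Finset.sum_congr rfl fun j _ => ?_
    rw [← Complex.exp_nat_mul, ← Complex.exp_neg, Complex.two_cos]
    congr 2 <;> ring

theorem zero_mult_ge_cN_of_mem_IZeroSet (d : ℕ) (hd : 1 ≤ d) :
    ∃ c : ℝ, 0 < c ∧ ∀ N : ℕ, 3 ≤ N → 1 ≤ torusMult N d 0 → d ∈ IZeroSet N →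
      c * N ≤ (torusMult N d 0 : ℝ) := by
  refine ⟨1, one_pos, fun N hN h1 hI => ?_⟩
  rw [one_mul, Nat.cast_le]
  obtain ⟨-, b, hb, p, hp, hbp⟩ := hI
  have hN0 : N ≠ 0 := by omega
  have hpp := Nat.prime_of_mem_primeFactors hp
  have hpN := Nat.dvd_of_mem_primeFactors hp
  have hpd : p ≤ d := by
    have h2 := Finset.single_le_sum (f := fun p => b p * p) (fun _ _ => Nat.zero_le _) hp
    have h3 : 2 * p ≤ b p * p := Nat.mul_le_mul_right p hbp
    omega
  have main : ∀ q r, d = q + r → 1 < q → q ∣ N → IsCosSum N r 0 → N ≤ torusMult N d 0 := by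
    rintro q r rfl hq hqN hr
    exact le_torusMult_of_isCosSum hN0 hq hqN hr
  have hpairs : ∀ n, 2 ∣ N → IsCosSum N (n * 2) 0 := fun n h2 => by
    simpa using (IsCosSum.of_two_dvd hN0 h2).mul n
  rcases Nat.even_or_odd N with hNe | hNo
  · have h2N := hNe.two_dvd
    have hd2 := hpp.two_le
    rcases Nat.even_or_odd' d with ⟨n, hn | hn⟩
    · exact main 2 ((n - 1) * 2) (by omega) one_lt_two h2N (hpairs _ h2N)
    · obtain ⟨m, rfl⟩ := h2N
      rcases Nat.even_or_odd m with hm | hm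
      · have h4 : 4 ∣ 2 * m := by
          obtain ⟨l, rfl⟩ := hm
          exact ⟨l, by ring⟩
        refine main 2 (1 + (n - 1) * 2) (by omega) one_lt_two (dvd_mul_right 2 m) ?_
        simpa using (IsCosSum.of_four_dvd hN0 h4).add (hpairs (n - 1) (dvd_mul_right 2 m))
      · by_cases hq : ∃ q : ℕ, q.Prime ∧ q ∣ m ∧ q ≤ d
        · obtain ⟨q, hqp, hqm, hqd⟩ := hq
          obtain ⟨l, hl⟩ := hm.of_dvd_nat hqm
          exact main q ((n - l) * 2) (by omega) hqp.one_lt (hqm.mul_left 2)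
            (hpairs _ (dvd_mul_right 2 m))
        · push Not at hq
          have : Nonempty {k : Fin d → Fin (2 * m) //
              (∑ j, 2 * Real.cos (2 * Real.pi * (k j : ℝ) / (2 * m : ℕ))) = 0} :=
            (Nat.card_pos_iff.1 (Nat.lt_of_lt_of_le Nat.zero_lt_one h1)).1
          obtain ⟨k, hk⟩ := this
          have := even_of_isCosSum_zero hm hq ⟨fun j => k j, hk⟩
          rw [hn] at this
          exact absurd this (by simp)
  · refine main p (d - p) (by omega) hpp.one_lt hpN
      (isCosSum_zero_of_odd hNo (fun l => if l = p then b p - 2 else b l) ?_)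
    rw [← Finset.add_sum_erase _ _ hp] at hb ⊢
    have h3 : ∑ l ∈ N.primeFactors.erase p, (if l = p then b p - 2 else b l) * l =
        ∑ l ∈ N.primeFactors.erase p, b l * l :=
      Finset.sum_congr rfl fun l hl => by rw [if_neg (Finset.ne_of_mem_erase hl)]
    rw [h3, if_pos rfl, Nat.sub_mul, Nat.mul_sub, hb]
    have h4 : 2 * p ≤ b p * p := Nat.mul_le_mul_right p hbp
    omega
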